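/- Let q be an odd prime power and let G = SL₂(𝔽_q). Then every irreducible complex character χ of G with Frobenius–Schur indicator ν₂(χ) = −1 satisfies χ(−I) = −χ(1), where −I is the unique central element of G of order 2. In particular, the central involution −I does not lie in the kernel of any quaternionic irreducible representation of SL₂(𝔽_q). -/

import Mathlib

open CategoryTheory

/-- The Frobenius–Schur indicator `ν₂(χ) = (1/|G|) ∑_{g ∈ G} χ(g²)` of a class function
`χ : G → ℂ`. -/
noncomputable def frobeniusSchurIndicator {G : Type*} [Group G] [Fintype G] (χ : G → ℂ) : ℂ :=
  (Fintype.card G : ℂ)⁻¹ * ∑ g : G, χ (g ^ 2)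

theorem FDRep.isIrreducible_ρ_of_simple {G : Type} [Group G] (V : FDRep ℂ G) [Simple V] :
    Representation.IsIrreducible (V.ρ : Representation ℂ G V) := by
  set ρ : Representation ℂ G V := V.ρ
  let Φ := forget₂ (FDRep ℂ G) (Rep ℂ G)
  have hnt : Nontrivial V := by
    by_contra h
    rw [not_nontrivial_iff_subsingleton] at h
    apply id_nonzero V
    apply Φ.map_injective
    ext x
    exact Subsingleton.elim (α := V) _ _
  have hne : (⊥ : Subrepresentation ρ) ≠ ⊤ := fun h =>
    bot_ne_top (α := Submodule ℂ V) (congrArg Subrepresentation.toSubmodule h)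
  refine { exists_pair_ne := ⟨_, _, hne⟩, eq_bot_or_eq_top := fun W => ?_ }
  let j : Φ.obj (FDRep.of W.toRepresentation) ⟶ Φ.obj V :=
    Rep.ofHom ⟨W.toSubmodule.subtype, fun g => rfl⟩
  have hj : Mono j := (Rep.mono_iff_injective j).2 Subtype.val_injective
  obtain ⟨i, hi⟩ := Φ.map_surjective j
  have : Mono i := Φ.mono_of_mono_map (hi ▸ hj)
  by_cases h0 : i = 0
  · left
    apply Subrepresentation.toSubmodule_injective
    refine (Submodule.eq_bot_iff _).2 fun x hx => ?_
    have hj0 : j = 0 := by rw [← hi, h0]; rfl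
    exact congrArg (fun f : Φ.obj (FDRep.of W.toRepresentation) ⟶ Φ.obj V => f.hom ⟨x, hx⟩) hj0
  · right
    apply Subrepresentation.toSubmodule_injective
    refine (Submodule.eq_top_iff').2 fun x => ?_
    have : IsIso i := isIso_of_mono_of_nonzero h0
    have : IsIso j := hi ▸ inferInstance
    obtain ⟨y, rfl⟩ := (Rep.epi_iff_surjective j).1 inferInstance x
    exact y.2

namespace Representation

variable {G V : Type*} [Group G] [AddCommGroup V] [Module ℂ V] {ρ : Representation ℂ G V}

theorem IsIrreducible.eq_bot_or_eq_top_of_invariant (hρ : ρ.IsIrreducible) (W : Submodule ℂ V)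
    (hW : ∀ g, ∀ x ∈ W, ρ g x ∈ W) : W = ⊥ ∨ W = ⊤ :=
  (hρ.eq_bot_or_eq_top ⟨W, hW⟩).imp (congrArg Subrepresentation.toSubmodule)
    (congrArg Subrepresentation.toSubmodule)

theorem IsIrreducible.nontrivial (hρ : ρ.IsIrreducible) : Nontrivial V := by
  by_contra h
  rw [not_nontrivial_iff_subsingleton] at h
  obtain ⟨W₁, W₂, hW⟩ := hρ.exists_pair_ne
  exact hW (Subrepresentation.toSubmodule_injective (Subsingleton.elim _ _))

theorem IsIrreducible.span_orbit_eq_top (hρ : ρ.IsIrreducible) {v : V} (hv : v ≠ 0) :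
    Submodule.span ℂ (Set.range fun g => ρ g v) = ⊤ := by
  refine (hρ.eq_bot_or_eq_top_of_invariant _ fun g x hx => ?_).resolve_left fun h => hv ?_
  · induction hx using Submodule.span_induction with
    | mem x hx =>
      obtain ⟨k, rfl⟩ := hx
      exact Submodule.subset_span ⟨g * k, by simp⟩
    | zero => simp
    | add x y _ _ hx hy => simpa using add_mem hx hy
    | smul c x _ hx => simpa using Submodule.smul_mem _ c hx
  · have : v ∈ Submodule.span ℂ (Set.range fun g => ρ g v) :=
      Submodule.subset_span ⟨1, by simp⟩
    simpa [h] using this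

/-- Schur's lemma. -/
theorem IsIrreducible.exists_eq_smul_one [FiniteDimensional ℂ V] (hρ : ρ.IsIrreducible)
    {T : V →ₗ[ℂ] V} (hT : ∀ g, T * ρ g = ρ g * T) : ∃ c : ℂ, T = c • 1 := by
  have := hρ.nontrivial
  obtain ⟨c, hc⟩ := Module.End.exists_eigenvalue T
  refine ⟨c, ?_⟩
  have htop := (hρ.eq_bot_or_eq_top_of_invariant (Module.End.eigenspace T c)
    fun g x hx => ?_).resolve_left hc
  · ext x
    have : x ∈ Module.End.eigenspace T c := htop ▸ Submodule.mem_top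
    simpa using Module.End.mem_eigenspace_iff.1 this
  · rw [Module.End.mem_eigenspace_iff] at hx ⊢
    rw [← Module.End.mul_apply, hT, Module.End.mul_apply, hx, map_smul]

theorem IsIrreducible.eq_zero_of_trace_mul_eq_zero [Finite G] [FiniteDimensional ℂ V]
    (hρ : ρ.IsIrreducible) {T : V →ₗ[ℂ] V} (hT : ∀ g, LinearMap.trace ℂ V (T * ρ g) = 0) :
    T = 0 := by
  have := hρ.nontrivial
  have := Fintype.ofFinite G
  have hn : (Module.finrank ℂ V : ℂ) ≠ 0 := by exact_mod_cast Module.finrank_pos.ne'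
  let b := Module.finBasis ℂ V
  ext y
  apply b.ext_elem
  intro j
  let X i : V →ₗ[ℂ] V := (b.coord i ∘ₗ T).smulRight y
  let A i : V →ₗ[ℂ] V := ∑ g, ρ g⁻¹ * X i * ρ g
  have hA i : ∃ c : ℂ, A i = c • 1 := by
    refine hρ.exists_eq_smul_one fun h => ?_
    simp only [A, Finset.sum_mul, Finset.mul_sum]
    refine Fintype.sum_equiv (Equiv.mulRight h) _ _ fun g => ?_
    have hgh : ρ g⁻¹ = ρ h * ρ (g * h)⁻¹ := by rw [← map_mul]; simp
    rw [Equiv.coe_mulRight, hgh, map_mul ρ g h]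
    simp only [mul_assoc]
  choose c hc using hA
  have htr i : c i * Module.finrank ℂ V = Fintype.card G * b.coord i (T y) := by
    have h1 : LinearMap.trace ℂ V (A i) = c i * Module.finrank ℂ V := by simp [hc]
    have h2 : LinearMap.trace ℂ V (A i) = Fintype.card G * b.coord i (T y) := by
      have h3 g : LinearMap.trace ℂ V (ρ g⁻¹ * X i * ρ g) = b.coord i (T y) := by
        rw [LinearMap.trace_mul_comm, ← mul_assoc, ← map_mul]
        simp [X, LinearMap.trace_smulRight]
      simp only [A, map_sum, h3]
      simp
    rw [← h1, h2]
  have hsum : ∑ i, A i (b i) = 0 := by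
    have h1 g : ∑ i, (ρ g⁻¹ * X i * ρ g) (b i) = 0 := by
      have := hT g
      rw [LinearMap.trace_eq_matrix_trace ℂ b, Matrix.trace] at this
      simp only [Matrix.diag_apply, LinearMap.toMatrix_apply] at this
      simp only [Module.End.mul_apply] at this ⊢
      simp only [X, LinearMap.smulRight_apply, LinearMap.comp_apply, map_smul,
        Module.Basis.coord_apply, ← Finset.sum_smul, this, zero_smul]
    simp only [A, LinearMap.sum_apply]
    rw [Finset.sum_comm]
    exact Finset.sum_eq_zero fun g _ => h1 g
  have hcj : c j = 0 := by
    simp only [hc, LinearMap.smul_apply, Module.End.one_apply] at hsum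
    exact Fintype.linearIndependent_iff.1 b.linearIndependent c hsum j
  have := htr j
  simpa [hcj] using this

theorem IsIrreducible.nondegenerate_of_ne_zero (hρ : ρ.IsIrreducible)
    {B : LinearMap.BilinForm ℂ V} (hB : B ≠ 0) (hinv : ∀ g x y, B (ρ g x) (ρ g y) = B x y) :
    Function.Injective B := by
  rw [← LinearMap.ker_eq_bot]
  refine (hρ.eq_bot_or_eq_top_of_invariant _ fun g x hx => ?_).resolve_right fun h => hB ?_
  · rw [LinearMap.mem_ker] at hx ⊢
    ext y
    have := hinv g x (ρ g⁻¹ y)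
    rw [ρ.self_inv_apply] at this
    simp [this, hx]
  · exact LinearMap.ker_eq_top.1 h

/-- If the indicator is negative, there is a nonzero invariant alternating form. -/
theorem exists_invariant_alternating_form [Fintype G] [FiniteDimensional ℂ V]
    (h : (Fintype.card G : ℂ)⁻¹ * ∑ g : G, ρ.character (g ^ 2) = -1) :
    ∃ B : LinearMap.BilinForm ℂ V, B ≠ 0 ∧ (∀ g x y, B (ρ g x) (ρ g y) = B x y) ∧
      ∀ x y, B x y = -B y x := by
  let b := Module.finBasis ℂ V
  let P i j : LinearMap.BilinForm ℂ V :=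
    ∑ g, LinearMap.BilinForm.linMulLin (b.coord i ∘ₗ ρ g) (b.coord j ∘ₗ ρ g)
  have hP i j x y : P i j x y = ∑ g, b.coord i (ρ g x) * b.coord j (ρ g y) := by
    simp [P, LinearMap.sum_apply]
  have hPinv i j k x y : P i j (ρ k x) (ρ k y) = P i j x y := by
    simp only [hP]
    refine Fintype.sum_equiv (Equiv.mulRight k) _ _ fun g => ?_
    simp
  by_contra! hcon
  have hsymm i j x y : P i j x y = P i j y x := by
    have := hcon (P i j - (P i j).flip)
    by_contra hne
    obtain ⟨x', y', hxy⟩ := this (fun h0 => hne (by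
      have := congrArg (fun f : LinearMap.BilinForm ℂ V => f x y) h0
      simpa [sub_eq_zero] using this)) (fun g x y => by simp [hPinv])
    simp at hxy
  have hchar g : ρ.character g = ∑ i, b.coord i (ρ g (b i)) := by
    rw [character, LinearMap.trace_eq_matrix_trace ℂ b, Matrix.trace]
    simp [LinearMap.toMatrix_apply]
  have hsq g : ρ.character (g ^ 2) = ∑ i, ∑ j, b.coord i (ρ g (b j)) * b.coord j (ρ g (b i)) := by
    rw [hchar]
    refine Finset.sum_congr rfl fun i _ => ?_
    rw [pow_two, map_mul, Module.End.mul_apply]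
    conv_lhs => rw [← b.sum_repr (ρ g (b i))]
    simp only [map_sum, map_smul, smul_eq_mul, Module.Basis.coord_apply, mul_comm]
  have hkey : ∑ g, ρ.character (g ^ 2) = ∑ g, (tprod ρ ρ).character g := by
    simp only [char_tensor, Pi.mul_apply, hsq, hchar, Finset.sum_mul_sum]
    rw [Finset.sum_comm]
    conv_rhs => rw [Finset.sum_comm]
    refine Finset.sum_congr rfl fun i _ => ?_
    rw [Finset.sum_comm]
    conv_rhs => rw [Finset.sum_comm]
    refine Finset.sum_congr rfl fun j _ => ?_
    rw [← hP, ← hP, hsymm]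
  have : Invertible (Nat.card G : ℂ) := invertibleOfNonzero (by simp)
  rw [hkey, Fintype.card_eq_nat_card, card_inv_mul_sum_char_eq_finrank] at h
  have h' : ((Module.finrank ℂ (tprod ρ ρ).invariants : ℤ) : ℂ) = ((-1 : ℤ) : ℂ) := by
    push_cast; exact h
  have := Int.cast_injective h'
  omega

/-- A matrix coefficient fixed by `g ↦ σ g⁻¹` yields a `σ`-semilinear intertwiner that is
skew-adjoint for `B`. -/
theorem IsIrreducible.exists_twisted_intertwiner (hρ : ρ.IsIrreducible)
    (σ : G →* G) (hσ : ∀ g, σ (σ g) = g) {B : LinearMap.BilinForm ℂ V}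
    (hinv : ∀ g x y, B (ρ g x) (ρ g y) = B x y) (halt : ∀ x y, B x y = -B y x) {v w : V}
    (hvw : B v w ≠ 0) (hf : ∀ g, B (ρ (σ g⁻¹) v) w = B (ρ g v) w) :
    ∃ T : V →ₗ[ℂ] V, T ≠ 0 ∧ (∀ g, T * ρ g = ρ (σ g) * T) ∧ ∀ x y, B (T x) y = -B x (T y) := by
  have hv : v ≠ 0 := by rintro rfl; simp at hvw
  have hspan := hρ.span_orbit_eq_top hv
  have hB : Function.Injective B :=
    hρ.nondegenerate_of_ne_zero (by rintro rfl; simp at hvw) hinv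
  have hmove g x y : B (ρ g x) y = B x (ρ g⁻¹ y) := by
    rw [← hinv g x, ρ.self_inv_apply]
  let Φ : (G →₀ ℂ) →ₗ[ℂ] V := Finsupp.linearCombination ℂ fun g => ρ g v
  let Ψ : (G →₀ ℂ) →ₗ[ℂ] V := Finsupp.linearCombination ℂ fun g => ρ (σ g) w
  have hΦ : LinearMap.range Φ = ⊤ := by
    rw [Finsupp.range_linearCombination, hspan]
  have hS g h : B (ρ h v) (ρ (σ g) w) = B (ρ (σ h⁻¹ * g) v) w := by
    rw [← neg_neg (B (ρ h v) _), ← halt, hmove, halt, neg_neg, ← map_inv, ← Module.End.mul_apply,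
      ← map_mul, ← hf]
    simp [hσ]
  have hSΨ h a : B (ρ h v) (Ψ a) = B (ρ (σ h⁻¹) (Φ a)) w := by
    induction a using Finsupp.induction_linear with
    | zero => simp
    | add a b ha hb => simp [ha, hb]
    | single g c => simp [Φ, Ψ, hS]
  have hker : LinearMap.ker Φ ≤ LinearMap.ker Ψ := by
    intro a ha
    rw [LinearMap.mem_ker] at ha ⊢
    apply hB
    rw [map_zero]
    refine LinearMap.ext_on_range hspan fun h => ?_
    rw [halt, hSΨ, ha]
    simp
  obtain ⟨s, hs⟩ := Φ.exists_rightInverse_of_surjective hΦ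
  have hT a : Ψ (s (Φ a)) = Ψ a := by
    rw [← sub_eq_zero, ← map_sub]
    apply hker
    rw [LinearMap.mem_ker, map_sub, ← LinearMap.comp_apply, hs]
    simp
  let T := Ψ ∘ₗ s
  have hTv g : T (ρ g v) = ρ (σ g) w := by
    simpa [T, Φ, Ψ] using hT (Finsupp.single g 1)
  refine ⟨T, ?_, fun g => ?_, fun x y => ?_⟩
  · intro h0
    have := hTv 1
    rw [h0] at this
    apply hvw
    simp at this
    simp [← this]
  · refine LinearMap.ext_on_range hspan fun h => ?_
    change T (ρ g (ρ h v)) = ρ (σ g) (T (ρ h v))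
    rw [hTv h, ← Module.End.mul_apply (ρ g), ← map_mul, hTv, map_mul, map_mul,
      Module.End.mul_apply]
  · have h1 : B ∘ₗ T = -(B.compl₂ T) := by
      refine LinearMap.ext_on_range hspan fun g => LinearMap.ext_on_range hspan fun h => ?_
      simp only [LinearMap.comp_apply, LinearMap.neg_apply, LinearMap.compl₂_apply, hTv]
      rw [halt, hS, hS, ← hf]
      simp [hσ]
    exact congrArg (fun f : LinearMap.BilinForm ℂ V => f x y) h1

theorem _root_.LinearMap.trace_eq_of_isAdjointPair [FiniteDimensional ℂ V]
    {B : LinearMap.BilinForm ℂ V} (hB : Function.Injective B) {S T : V →ₗ[ℂ] V}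
    (hST : ∀ x y, B (S x) y = B x (T y)) : LinearMap.trace ℂ V S = LinearMap.trace ℂ V T := by
  let e : V ≃ₗ[ℂ] Module.Dual ℂ V :=
    LinearEquiv.ofInjectiveOfFinrankEq B hB Subspace.dual_finrank_eq.symm
  rw [← LinearMap.trace_transpose' T, ← LinearMap.trace_conj' S e]
  congr 1
  ext f x
  obtain ⟨y, rfl⟩ := e.surjective f
  have he y : e y = B y := rfl
  simpa [LinearEquiv.conj_apply, ← he, Module.Dual.transpose_apply] using hST y x

theorem IsIrreducible.not_exists_alternating_of_twisted [Finite G] [FiniteDimensional ℂ V]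
    (hρ : ρ.IsIrreducible)
    (σ : G →* G) (hσ : ∀ g, σ (σ g) = g) (hconj : ∀ g, ∃ k, ρ g⁻¹ = ρ (σ k * g * k⁻¹))
    {B : LinearMap.BilinForm ℂ V}
    (hinv : ∀ g x y, B (ρ g x) (ρ g y) = B x y) (halt : ∀ x y, B x y = -B y x) {v w : V}
    (hvw : B v w ≠ 0) (hf : ∀ g, B (ρ (σ g⁻¹) v) w = B (ρ g v) w) : False := by
  obtain ⟨T, hT0, hTσ, hTB⟩ := hρ.exists_twisted_intertwiner σ hσ hinv halt hvw hf
  have hB : Function.Injective B :=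
    hρ.nondegenerate_of_ne_zero (by rintro rfl; simp at hvw) hinv
  refine hT0 (hρ.eq_zero_of_trace_mul_eq_zero fun g => ?_)
  have h1 : LinearMap.trace ℂ V (T * ρ g) = LinearMap.trace ℂ V (-(ρ g⁻¹ * T)) := by
    refine LinearMap.trace_eq_of_isAdjointPair hB fun x y => ?_
    rw [Module.End.mul_apply, hTB, ← hinv g⁻¹]
    simp
  have h2 : LinearMap.trace ℂ V (ρ g⁻¹ * T) = LinearMap.trace ℂ V (T * ρ g) := by
    obtain ⟨k, hk⟩ := hconj g
    have hTk : T * ρ (σ k) = ρ k * T := by rw [hTσ, hσ]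
    rw [LinearMap.trace_mul_comm, hk, map_mul ρ, map_mul ρ, ← mul_assoc, ← mul_assoc, hTk,
      LinearMap.trace_mul_comm, ← mul_assoc, ← mul_assoc, ← map_mul ρ]
    simp
  rw [map_neg, h2] at h1
  exact self_eq_neg.1 h1

end Representation

/-- Decomposition of a vector into eigenvectors of an additive action of a finite group. -/
theorem AddChar.exists_eigenvector_pair {F V : Type*} [AddCommGroup F] [Fintype F]
    [AddCommGroup V] [Module ℂ V] (R : Representation ℂ (Multiplicative F) V)
    (B : LinearMap.BilinForm ℂ V) (hB : Function.Injective B)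
    (hinv : ∀ g x y, B (R g x) (R g y) = B x y) (hR : ∃ g, R g ≠ 1) :
    ∃ (ψ : AddChar F ℂ) (v w : V), ψ ≠ 1 ∧ B v w ≠ 0 ∧ (∀ t, R (.ofAdd t) v = ψ t • v) ∧
      ∀ t, R (.ofAdd t) w = ψ (-t) • w := by
  classical
  let e (ψ : AddChar F ℂ) (x : V) : V := ∑ t, ψ (-t) • R (.ofAdd t) x
  have he ψ x s : R (.ofAdd s) (e ψ x) = ψ s • e ψ x := by
    simp only [e, map_sum, map_smul, Finset.smul_sum, smul_smul, ← AddChar.map_add_eq_mul]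
    refine Fintype.sum_equiv (Equiv.addLeft s) _ _ fun t => ?_
    have ht : -t = s + -(s + t) := by abel
    rw [Equiv.coe_addLeft, ofAdd_add, map_mul, Module.End.mul_apply, ← ht]
  have hsum x : ∑ ψ, e ψ x = (Fintype.card F : ℂ) • x := by
    simp only [e]
    rw [Finset.sum_comm]
    simp_rw [← Finset.sum_smul, AddChar.sum_apply_eq_ite]
    simp
  have hq : (Fintype.card F : ℂ) ≠ 0 := by simp
  obtain ⟨ψ, hψ, x, hx⟩ : ∃ ψ : AddChar F ℂ, ψ ≠ 1 ∧ ∃ x, e ψ x ≠ 0 := by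
    by_contra! hcon
    obtain ⟨g, hg⟩ := hR
    refine hg (LinearMap.ext fun x => ?_)
    have hx : e 1 x = (Fintype.card F : ℂ) • x := by
      rw [← hsum, Finset.sum_eq_single 1 (fun ψ _ hψ => hcon ψ hψ x) (by simp)]
    have := he 1 x g.toAdd
    rw [hx, map_smul, AddChar.one_apply, one_smul] at this
    simpa using smul_right_injective V hq this
  set v := e ψ x
  have hv : ∀ t, R (.ofAdd t) v = ψ t • v := he ψ x
  obtain ⟨y, hy⟩ : ∃ y, B v y ≠ 0 := by
    by_contra! hcon
    exact hx (hB (by ext y; simp [hcon]))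
  refine ⟨ψ, v, e ψ⁻¹ y, hψ, ?_, hv, fun t => by rw [he, AddChar.inv_apply]⟩
  have hterm t : ψ⁻¹ (-t) * B v (R (.ofAdd t) y) = B v y := by
    rw [← hinv (.ofAdd t) v y, hv, map_smul, LinearMap.smul_apply, smul_eq_mul,
      AddChar.inv_apply, neg_neg]
  simp only [e, map_sum, map_smul, smul_eq_mul, hterm]
  simpa using hy

namespace Matrix.SpecialLinearGroup

variable {F : Type*} [Field F]

/-- The upper unipotent element with off-diagonal entry `t`. -/
def upper (t : F) : SpecialLinearGroup (Fin 2) F := ⟨!![1, t; 0, 1], by simp⟩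

/-- The lower unipotent element with off-diagonal entry `t`. -/
def lower (t : F) : SpecialLinearGroup (Fin 2) F := ⟨!![1, 0; t, 1], by simp⟩

/-- The Weyl element. -/
def weyl : SpecialLinearGroup (Fin 2) F := ⟨!![0, 1; -1, 0], by simp⟩

@[simp] theorem coe_upper (t : F) : (upper t : Matrix (Fin 2) (Fin 2) F) = !![1, t; 0, 1] := rfl

@[simp] theorem coe_lower (t : F) : (lower t : Matrix (Fin 2) (Fin 2) F) = !![1, 0; t, 1] := rfl

@[simp] theorem coe_weyl : ((weyl : SpecialLinearGroup (Fin 2) F) : Matrix (Fin 2) (Fin 2) F) =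
    !![0, 1; -1, 0] := rfl

theorem mul_entry (g h : SpecialLinearGroup (Fin 2) F) (i j : Fin 2) :
    (g * h) i j = g i 0 * h 0 j + g i 1 * h 1 j := by
  rw [coe_mul, _root_.Matrix.mul_apply, Fin.sum_univ_two]

theorem coe_inv_fin_two (g : SpecialLinearGroup (Fin 2) F) :
    ((g⁻¹ : SpecialLinearGroup (Fin 2) F) : Matrix (Fin 2) (Fin 2) F) =
      !![g 1 1, -g 0 1; -g 1 0, g 0 0] := by
  rw [coe_inv, adjugate_fin_two]

/-- The upper unipotent elements as a homomorphism. -/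
def upperHom : Multiplicative F →* SpecialLinearGroup (Fin 2) F where
  toFun t := upper t.toAdd
  map_one' := by ext i j; fin_cases i <;> fin_cases j <;> simp
  map_mul' s t := by
    ext i j; fin_cases i <;> fin_cases j <;> simp [-coe_mul, mul_entry, add_comm]

theorem det_eq (g : SpecialLinearGroup (Fin 2) F) : g 0 0 * g 1 1 - g 0 1 * g 1 0 = 1 := by
  rw [← det_fin_two, g.det_coe]

/-- Conjugation by `diag(1, -1)`. -/
def diagConj : SpecialLinearGroup (Fin 2) F →* SpecialLinearGroup (Fin 2) F where
  toFun g := ⟨!![g 0 0, -g 0 1; -g 1 0, g 1 1], by simpa using det_eq g⟩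
  map_one' := by ext i j; fin_cases i <;> fin_cases j <;> simp
  map_mul' s t := by
    refine Subtype.ext ?_
    change !![(s * t) 0 0, -(s * t) 0 1; -(s * t) 1 0, (s * t) 1 1] =
      !![s 0 0, -s 0 1; -s 1 0, s 1 1] * !![t 0 0, -t 0 1; -t 1 0, t 1 1]
    ext i j
    fin_cases i <;> fin_cases j <;> simp [-coe_mul, mul_entry] <;> ring

@[simp] theorem coe_diagConj (g : SpecialLinearGroup (Fin 2) F) :
    (diagConj g : Matrix (Fin 2) (Fin 2) F) = !![g 0 0, -g 0 1; -g 1 0, g 1 1] := rfl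

theorem diagConj_diagConj (g : SpecialLinearGroup (Fin 2) F) : diagConj (diagConj g) = g := by
  ext i j; fin_cases i <;> fin_cases j <;> simp

theorem diagConj_inv (g : SpecialLinearGroup (Fin 2) F) :
    (diagConj g⁻¹ : Matrix (Fin 2) (Fin 2) F) = !![g 1 1, g 0 1; g 1 0, g 0 0] := by
  ext i j; fin_cases i <;> fin_cases j <;> simp [-map_inv, -coe_inv, coe_inv_fin_two]

theorem exists_mul_eq_diagConj_mul {z : SpecialLinearGroup (Fin 2) F}
    (hz : (z : Matrix (Fin 2) (Fin 2) F) = -1) (g : SpecialLinearGroup (Fin 2) F) :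
    ∃ k, z * g⁻¹ * k = diagConj k * g := by
  have hdet := det_eq g
  have hcoe (k : SpecialLinearGroup (Fin 2) F) : z * g⁻¹ * k = diagConj k * g ↔
      ∀ i j, -((g⁻¹ * k : SpecialLinearGroup (Fin 2) F) i j) = (diagConj k * g) i j := by
    rw [mul_assoc, SpecialLinearGroup.ext_iff]
    simp [coe_mul, hz]
  simp only [hcoe]
  by_cases h10 : g 1 0 = 0
  · by_cases h01 : g 0 1 = 0
    · refine ⟨weyl, fun i j => ?_⟩
      fin_cases i <;> fin_cases j <;>
        simp [-coe_mul, -coe_inv, mul_entry, coe_inv_fin_two, h10, h01]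
    · refine ⟨lower ((g 0 0 + g 1 1) / g 0 1), fun i j => ?_⟩
      fin_cases i <;> fin_cases j <;>
        simp [-coe_mul, -coe_inv, mul_entry, coe_inv_fin_two, h10] <;>
        field_simp <;> grind
  · refine ⟨upper ((g 0 0 + g 1 1) / g 1 0), fun i j => ?_⟩
    fin_cases i <;> fin_cases j <;>
      simp [-coe_mul, -coe_inv, mul_entry, coe_inv_fin_two] <;>
      field_simp <;> grind

theorem eq_upper_mul_lower_mul_upper {g : SpecialLinearGroup (Fin 2) F} (hg : g 1 0 ≠ 0) :
    g = upper ((g 0 0 - 1) / g 1 0) * lower (g 1 0) * upper ((g 1 1 - 1) / g 1 0) := by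
  have hdet := det_eq g
  ext i j
  fin_cases i <;> fin_cases j <;>
    simp [-coe_mul, -map_inv, mul_entry] <;> field_simp <;> grind

theorem lower_eq_conj (t : F) : lower t = weyl⁻¹ * upper (-t) * weyl := by
  ext i j
  fin_cases i <;> fin_cases j <;>
    simp [-coe_mul, -coe_inv, mul_entry, coe_inv_fin_two]

theorem map_eq_one_of_upper {M : Type*} [Monoid M] (f : SpecialLinearGroup (Fin 2) F →* M)
    (hf : ∀ t, f (upper t) = 1) (g : SpecialLinearGroup (Fin 2) F) : f g = 1 := by
  have hlower t : f (lower t) = 1 := by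
    rw [lower_eq_conj, map_mul, map_mul, hf, mul_one, ← map_mul, inv_mul_cancel, map_one]
  have hmain (g : SpecialLinearGroup (Fin 2) F) (hg : g 1 0 ≠ 0) : f g = 1 := by
    rw [eq_upper_mul_lower_mul_upper hg]
    simp [hf, hlower]
  by_cases hg : g 1 0 = 0
  · have h00 : g 0 0 ≠ 0 := fun h => by simpa [h, hg] using det_eq g
    suffices h : f (lower 1 * g) = 1 by rwa [map_mul, hlower, one_mul] at h
    apply hmain
    simpa [-coe_mul, -map_inv, mul_entry, hg] using h00
  · exact hmain g hg

/-- Uniqueness of Whittaker functionals: a function on `SL₂(F)` that is bi-equivariant for a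
nontrivial character of the upper unipotent subgroup is fixed by `g ↦ diagConj g⁻¹`. -/
theorem apply_diagConj_inv {ψ : AddChar F ℂ} (hψ : ψ ≠ 1)
    {f : SpecialLinearGroup (Fin 2) F → ℂ} (hl : ∀ t g, f (upper t * g) = ψ t * f g)
    (hr : ∀ t g, f (g * upper t) = ψ t * f g) (g : SpecialLinearGroup (Fin 2) F) :
    f (diagConj g⁻¹) = f g := by
  have hvanish (g : SpecialLinearGroup (Fin 2) F) (hg : g 1 0 = 0) (hg' : g 0 0 ≠ g 1 1) :
      f g = 0 := by
    have hdet : g 0 0 * g 1 1 = 1 := by simpa [hg] using det_eq g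
    by_contra hne
    refine hψ (DFunLike.ext _ _ fun x => ?_)
    have key t : ψ ((g 0 0 ^ 2 - 1) * t) = 1 := by
      have h : g * upper t = upper (g 0 0 ^ 2 * t) * g := by
        ext i j
        fin_cases i <;> fin_cases j <;>
          simp [-coe_mul, -map_inv, mul_entry, hg]
        grind
      have h' := congrArg f h
      rw [hl, hr] at h'
      have h'' := mul_right_cancel₀ hne h'
      rw [sub_mul, one_mul, AddChar.map_sub_eq_div, ← h'', div_self]
      exact (ψ.val_isUnit t).ne_zero
    have hsq : g 0 0 ^ 2 - 1 ≠ 0 := by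
      intro h0
      apply hg'
      grind
    have := key (x / (g 0 0 ^ 2 - 1))
    rwa [mul_div_cancel₀ _ hsq] at this
  have hentry i j : (diagConj g⁻¹) i j = !![g 1 1, g 0 1; g 1 0, g 0 0] i j := by
    rw [← diagConj_inv]
  by_cases hg : g 1 0 = 0
  · by_cases hg' : g 0 0 = g 1 1
    · congr 1
      ext i j
      rw [hentry]
      fin_cases i <;> fin_cases j <;> simp [hg']
    · rw [hvanish g hg hg', hvanish _ (by simp [hg]) (by simpa [hentry] using Ne.symm hg')]
  · have hdet := det_eq g
    have h : upper ((g 1 1 - g 0 0) / g 1 0) * g =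
        diagConj g⁻¹ * upper ((g 1 1 - g 0 0) / g 1 0) := by
      ext i j
      fin_cases i <;> fin_cases j <;>
        simp [-coe_mul, -map_inv, mul_entry, hentry] <;> field_simp <;> grind
    have h' := congrArg f h
    rw [hl, hr] at h'
    exact (mul_left_cancel₀ (ψ.val_isUnit _).ne_zero h').symm

end Matrix.SpecialLinearGroup

namespace Representation

open Matrix.SpecialLinearGroup in
/-- An irreducible representation of `SL₂(F)` with central element `-1` acting trivially carries
no nonzero invariant alternating form. -/
theorem IsIrreducible.ne_one_of_alternating {F V : Type*} [Field F] [Fintype F] [DecidableEq F]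
    [AddCommGroup V] [Module ℂ V] [FiniteDimensional ℂ V]
    {ρ : Representation ℂ (Matrix.SpecialLinearGroup (Fin 2) F) V} (hρ : ρ.IsIrreducible)
    {B : LinearMap.BilinForm ℂ V} (hB : B ≠ 0)
    (hinv : ∀ g x y, B (ρ g x) (ρ g y) = B x y) (halt : ∀ x y, B x y = -B y x)
    {z : Matrix.SpecialLinearGroup (Fin 2) F} (hz : (z : Matrix (Fin 2) (Fin 2) F) = -1) :
    ρ z ≠ 1 := by
  intro hz1
  have hconj g : ∃ k, ρ g⁻¹ = ρ (diagConj k * g * k⁻¹) := by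
    obtain ⟨k, hk⟩ := exists_mul_eq_diagConj_mul hz g
    refine ⟨k, ?_⟩
    rw [← hk, mul_inv_cancel_right, map_mul, hz1, one_mul]
  suffices h : ∃ v w, B v w ≠ 0 ∧ ∀ g, B (ρ (diagConj g⁻¹) v) w = B (ρ g v) w by
    obtain ⟨v, w, hvw, hf⟩ := h
    exact hρ.not_exists_alternating_of_twisted diagConj diagConj_diagConj hconj hinv halt hvw hf
  by_cases htriv : ∀ t, ρ (upper t) = 1
  · have hone := map_eq_one_of_upper ρ htriv
    obtain ⟨v, hv⟩ := DFunLike.ne_iff.1 hB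
    obtain ⟨w, hw⟩ := DFunLike.ne_iff.1 hv
    exact ⟨v, w, hw, fun g => by rw [hone, hone]⟩
  · obtain ⟨t, ht⟩ := not_forall.1 htriv
    obtain ⟨ψ, v, w, hψ, hvw, hv, hw⟩ := AddChar.exists_eigenvector_pair (ρ.comp upperHom) B
      (hρ.nondegenerate_of_ne_zero hB hinv) (fun g => hinv _) ⟨.ofAdd t, ht⟩
    have hv' t : ρ (upper t) v = ψ t • v := hv t
    have hw' t : ρ (upper t) w = ψ (-t) • w := hw t
    refine ⟨v, w, hvw, apply_diagConj_inv (f := fun g => B (ρ g v) w) hψ (fun t g => ?_)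
      fun t g => ?_⟩
    · have hwt : w = ψ t • ρ (upper t) w := by
        rw [hw', smul_smul, ← AddChar.map_add_eq_mul]
        simp
      conv_lhs => rw [hwt]
      rw [map_smul, map_mul, Module.End.mul_apply, hinv, smul_eq_mul]
    · simp only [map_mul, Module.End.mul_apply, hv', map_smul, LinearMap.smul_apply, smul_eq_mul]

end Representation

/-- Let `F` be a finite field of odd order `q` (so `q` is an odd prime power) and let
`G = SL₂(F)`.  Then every irreducible complex character `χ` of `G` with Frobenius–Schur
indicator `ν₂(χ) = −1` satisfies `χ(−I) = −χ(1)`, where `−I` is the unique central element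
of `G` of order `2`.  In particular `−I` does not lie in the kernel of any quaternionic
irreducible representation of `SL₂(F)`. -/
theorem SL2_quaternionic_character_central_involution
    (F : Type) [Field F] [Fintype F] [DecidableEq F] (hodd : Odd (Fintype.card F))
    (V : FDRep ℂ (Matrix.SpecialLinearGroup (Fin 2) F)) (hV : Simple V)
    (hind : frobeniusSchurIndicator V.character = -1)
    (z : Matrix.SpecialLinearGroup (Fin 2) F)
    (hz : (z : Matrix (Fin 2) (Fin 2) F) = -1) :
    V.character z = -V.character 1 ∧ V.ρ z ≠ 1 := by
  have hρ : Representation.IsIrreducible V.ρ := V.isIrreducible_ρ_of_simple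
  obtain ⟨B, hB, hinv, halt⟩ := Representation.exists_invariant_alternating_form (ρ := V.ρ) hind
  have hz1 : V.ρ z ≠ 1 := hρ.ne_one_of_alternating hB hinv halt hz
  refine ⟨?_, hz1⟩
  have hcomm g : z * g = g * z := by
    apply Subtype.ext
    change (z * g : Matrix (Fin 2) (Fin 2) F) = g * z
    simp [hz]
  have hsq : z * z = 1 := by
    apply Subtype.ext
    change (z * z : Matrix (Fin 2) (Fin 2) F) = 1
    simp [hz]
  obtain ⟨c, hc⟩ := hρ.exists_eq_smul_one (T := V.ρ z) fun g => by
    rw [← map_mul, hcomm, map_mul]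
  have := hρ.nontrivial
  obtain ⟨x, hx⟩ := exists_ne (0 : V)
  have hcc : c * c = 1 := by
    have h : V.ρ (z * z) x = x := by rw [hsq, map_one, Module.End.one_apply]
    rw [map_mul, hc] at h
    simp only [Module.End.mul_apply, LinearMap.smul_apply, Module.End.one_apply, smul_smul] at h
    exact smul_left_injective ℂ hx (by simpa using h)
  have hc1 : c = -1 := by
    refine (mul_self_eq_one_iff.1 hcc).resolve_left fun h => hz1 ?_
    rw [hc, h, one_smul]
  change LinearMap.trace ℂ V (V.ρ z) = -LinearMap.trace ℂ V (V.ρ 1)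
  rw [hc, hc1, map_one, map_smul, neg_one_smul]
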